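/- Let A be a finite central arrangement in an ℓ-dimensional Euclidean space, m : A → ℤ a multiplicity, H ∈ A a fixed hyperplane with m(H) = m, and x₁, …, x_ℓ an orthonormal basis of V* with H = {x₁ = 0}. Define the multiplicity m' by m'(K) := |m(K)| for K ≠ H and m'(H) := 0, and Q^{m'} := ∏_{K∈A} α_K^{m'(K)}. Then the forms η₁ := Q^{m'} (dx₁ / x₁^m), η₂ := Q^{m'} dx₂, …, η_ℓ := Q^{m'} dx_ℓ all lie in Ω(A, m). -/

import Mathlib

open MvPolynomial

noncomputable section CoxeterFormalization

/-! ### The ambient rings: `S = Sym(V*)`, `F = Frac(S)`, rational 1-forms.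

We model the `ℓ`-dimensional Euclidean space `V` as `ℝ^ℓ` with its standard
(orthonormal) coordinates, so that `S = ℝ[x_0, …, x_{ℓ-1}]`, and a rational
differential 1-form `ω = Σ ω_x dx_x` (equivalently, a rational derivation
`ξ = Σ ξ_x ∂_x`) is recorded by its component vector `(ω_x)_x : Fin ℓ → F`. -/

abbrev Spoly (ℓ : ℕ) := MvPolynomial (Fin ℓ) ℝ
abbrev Ffield (ℓ : ℕ) := FractionRing (Spoly ℓ)
abbrev OmF (ℓ : ℕ) := Fin ℓ → Ffield ℓ

variable {ℓ t : ℕ}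

/-- The image of `S` in `F`: the "regular" (polynomial) rational functions. -/
def Sreg (ℓ : ℕ) : Set (Ffield ℓ) := Set.range (algebraMap (Spoly ℓ) (Ffield ℓ))

def toF (p : Spoly ℓ) : Ffield ℓ := algebraMap (Spoly ℓ) (Ffield ℓ) p

/-- The linear form `α = Σ a_x · x_x ∈ V*` attached to a normal vector `a`. -/
def linForm (a : Fin ℓ → ℝ) : Spoly ℓ := ∑ x, MvPolynomial.C (a x) * MvPolynomial.X x

def linF (a : Fin ℓ → ℝ) : Ffield ℓ := toF (linForm a)

def cF (r : ℝ) : Ffield ℓ := toF (MvPolynomial.C r)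

def XF (x : Fin ℓ) : Ffield ℓ := toF (MvPolynomial.X x)

/-- `Q = ∏_{H ∈ A} α_H`, as an element of `F`. -/
def QF (A : Finset (Fin ℓ → ℝ)) : Ffield ℓ := toF (∏ a ∈ A, linForm a)

/-- `Q^m = ∏_{H ∈ A} α_H^{m(H)}` for an integral multiplicity `m`. -/
def QmF (A : Finset (Fin ℓ → ℝ)) (m : (Fin ℓ → ℝ) → ℤ) : Ffield ℓ :=
  ∏ a ∈ A, linF a ^ m a

/-- Ziegler's module `Ω(A,∞)` of logarithmic 1-forms:
`Q^N ω` and `(Q/α_H)^N dα_H ∧ ω` regular for `N ≫ 0`.  The wedge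
`dα_H ∧ ω` is recorded by its components `a_x ω_y - a_y ω_x`. -/
def OmegaInf (A : Finset (Fin ℓ → ℝ)) : Set (OmF ℓ) :=
  {ω | ∃ N : ℕ,
    (∀ x, QF A ^ N * ω x ∈ Sreg ℓ) ∧
    ∀ a ∈ A, ∀ x y,
      (QF A / linF a) ^ N * (cF (a x) * ω y - cF (a y) * ω x) ∈ Sreg ℓ}

/-- `Ω(A,m)` for an arbitrary multiplicity `m : A → ℤ`: those `ω ∈ Ω(A,∞)` with
`(Q/α_H)^N α_H^{m(H)} I*(dα_H, ω) ∈ S` for `N ≫ 0`; here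
`I*(dα_H, ω) = Σ_x a_x ω_x` (the coordinates are orthonormal). -/
def OmegaMult (A : Finset (Fin ℓ → ℝ)) (m : (Fin ℓ → ℝ) → ℤ) : Set (OmF ℓ) :=
  {ω ∈ OmegaInf A | ∃ N : ℕ,
    ∀ a ∈ A, (QF A / linF a) ^ N * linF a ^ m a * (∑ x, cF (a x) * ω x) ∈ Sreg ℓ}

/-! ### The action of `GL_ℓ(ℝ)` on `S`, `F` and on component vectors. -/

/-- Substitution `x_i ↦ Σ_j M_{i j} x_j`, i.e. `f ↦ f ∘ M`. -/
def matSub (M : Matrix (Fin ℓ) (Fin ℓ) ℝ) : Spoly ℓ →ₐ[ℝ] Spoly ℓ :=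
  MvPolynomial.aeval fun x => ∑ y, MvPolynomial.C (M x y) * MvPolynomial.X y

lemma matSub_comp (M N : Matrix (Fin ℓ) (Fin ℓ) ℝ) :
    (matSub M).comp (matSub N) = matSub (N * M) := by
  apply MvPolynomial.algHom_ext
  intro x
  simp only [matSub, AlgHom.coe_comp, Function.comp_apply, aeval_X, map_sum, map_mul, aeval_C,
    Matrix.mul_apply, C_mul, Finset.sum_mul, Finset.mul_sum, MvPolynomial.algebraMap_eq,
    mul_assoc]
  rw [Finset.sum_comm]

lemma matSub_one : matSub (1 : Matrix (Fin ℓ) (Fin ℓ) ℝ) = AlgHom.id ℝ (Spoly ℓ) := by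
  apply MvPolynomial.algHom_ext
  intro x
  simp [matSub, Matrix.one_apply, apply_ite MvPolynomial.C, ite_mul, Finset.sum_ite_eq]

lemma matSub_injective (g : Matrix.GeneralLinearGroup (Fin ℓ) ℝ) :
    Function.Injective (matSub (↑g : Matrix (Fin ℓ) (Fin ℓ) ℝ)) := by
  intro p q h
  have h3 : (matSub (↑g⁻¹ : Matrix (Fin ℓ) (Fin ℓ) ℝ)).comp
      (matSub (↑g : Matrix (Fin ℓ) (Fin ℓ) ℝ)) = AlgHom.id ℝ (Spoly ℓ) := by
    rw [matSub_comp]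
    have h1 : ((↑g : Matrix (Fin ℓ) (Fin ℓ) ℝ) * (↑g⁻¹ : Matrix (Fin ℓ) (Fin ℓ) ℝ))
        = (1 : Matrix (Fin ℓ) (Fin ℓ) ℝ) := by
      rw [← Units.val_mul]; simp
    rw [h1, matSub_one]
  have h2 := congrArg (matSub (↑g⁻¹ : Matrix (Fin ℓ) (Fin ℓ) ℝ)) h
  rwa [← AlgHom.comp_apply, ← AlgHom.comp_apply, h3, AlgHom.id_apply, AlgHom.id_apply] at h2

/-- The action of `g ∈ GL_ℓ(ℝ)` on rational functions, `f ↦ f ∘ g⁻¹`. -/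
def fAct (g : Matrix.GeneralLinearGroup (Fin ℓ) ℝ) : Ffield ℓ →+* Ffield ℓ :=
  IsFractionRing.lift (g :=
    (algebraMap (Spoly ℓ) (Ffield ℓ)).comp
      (matSub (↑g⁻¹ : Matrix (Fin ℓ) (Fin ℓ) ℝ)).toRingHom)
    ((IsFractionRing.injective (Spoly ℓ) (Ffield ℓ)).comp (matSub_injective g⁻¹))

/-- The natural action of an **orthogonal** `g` on the component vector of a
differential 1-form (equivalently, of a derivation): `(g·v)_x = Σ_y g_{x y} · g(v_y)`. -/
def vecAct (g : Matrix.GeneralLinearGroup (Fin ℓ) ℝ) (v : OmF ℓ) : OmF ℓ :=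
  fun x => ∑ y, cF ((↑g : Matrix (Fin ℓ) (Fin ℓ) ℝ) x y) * fAct g (v y)

/-- `W`-invariant component vectors (1-forms/derivations). -/
def InvVec (W : Subgroup (Matrix.GeneralLinearGroup (Fin ℓ) ℝ)) : Set (OmF ℓ) :=
  {ω | ∀ g ∈ W, vecAct g ω = ω}

/-- `Ω(A,∞)^W`. -/
def OmegaInfW (A : Finset (Fin ℓ → ℝ)) (W : Subgroup (Matrix.GeneralLinearGroup (Fin ℓ) ℝ)) :
    Set (OmF ℓ) := OmegaInf A ∩ InvVec W

/-- `Ω(A,m)^W = Ω(A,m) ∩ Ω(A,∞)^W`. -/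
def OmegaMultW (A : Finset (Fin ℓ → ℝ)) (W : Subgroup (Matrix.GeneralLinearGroup (Fin ℓ) ℝ))
    (m : (Fin ℓ → ℝ) → ℤ) : Set (OmF ℓ) := OmegaMult A m ∩ InvVec W

/-- `W`-invariant polynomials. -/
def InvPoly (W : Subgroup (Matrix.GeneralLinearGroup (Fin ℓ) ℝ)) : Set (Spoly ℓ) :=
  {p | ∀ g ∈ W, matSub (↑g : Matrix (Fin ℓ) (Fin ℓ) ℝ) p = p}

/-- The invariant ring `R = S^W`, viewed inside `F`. -/
def RF (W : Subgroup (Matrix.GeneralLinearGroup (Fin ℓ) ℝ)) : Set (Ffield ℓ) :=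
  toF '' InvPoly W

/-- The orthogonal reflection through the hyperplane `ker⟨a, ·⟩`. -/
def reflMat (a : Fin ℓ → ℝ) : Matrix (Fin ℓ) (Fin ℓ) ℝ :=
  1 - (2 / ∑ x, a x * a x) • Matrix.vecMulVec a a

/-! ### Block (irreducible-factor) structure. -/

/-- A polynomial involving only the variables of the block `i` (w.r.t. the block
assignment `blk : Fin ℓ → Fin t`). -/
def blockPoly (blk : Fin ℓ → Fin t) (i : Fin t) (p : Spoly ℓ) : Prop :=
  ∀ m ∈ p.support, ∀ x ∈ Finsupp.support m, blk x = i

/-- Rational functions in the variables of block `i` only. -/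
def blockFrac (blk : Fin ℓ → Fin t) (i : Fin t) : Set (Ffield ℓ) :=
  {y | ∃ p q : Spoly ℓ, blockPoly blk i p ∧ blockPoly blk i q ∧ q ≠ 0 ∧ y * toF q = toF p}

/-- A component vector belonging to the factor `V[i]`:  components outside block `i`
vanish and all components are rational functions of the block-`i` variables. -/
def BlockVec (blk : Fin ℓ → Fin t) (i : Fin t) (ω : OmF ℓ) : Prop :=
  (∀ x, blk x ≠ i → ω x = 0) ∧ ∀ x, ω x ∈ blockFrac blk i

/-- All the data of a (not necessarily irreducible) Coxeter arrangement `A` in the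
Euclidean space `V = ℝ^ℓ`, together with its decomposition into `t` irreducible
factors and a system of basic invariants:

* `A` is a finite set of hyperplanes, recorded by nonzero defining normal vectors,
  pairwise non-proportional;
* `W` is a finite subgroup of `GL_ℓ(ℝ)` consisting of orthogonal transformations,
  generated by the reflections through the members of `A`, and `A` is exactly the
  set of reflecting hyperplanes of `W` (so `A` is the Coxeter arrangement of the
  finite real reflection group `W`);
* `blk` assigns to every coordinate its irreducible block `V[i]`, every hyperplane
  of `A` lies over a single block;
* `P c` (`c : Fin ℓ`) are basic invariants: homogeneous, `W`-invariant,
  algebraically independent generators of `R = S^W`, the invariants of the block `i`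
  being those `P c` with `blk c = i` and involving only block-`i` variables;
* within each block `i` the invariant `P (top i)` has strictly largest degree
  (this uses irreducibility of the factors; it makes the primitive derivations
  `D[i] = ∂/∂P_{ℓ[i]}[i]` well defined up to constants). -/
structure CoxeterSetup (ℓ t : ℕ) where
  A : Finset (Fin ℓ → ℝ)
  W : Subgroup (Matrix.GeneralLinearGroup (Fin ℓ) ℝ)
  hA0 : ∀ a ∈ A, a ≠ 0
  hAprop : ∀ a ∈ A, ∀ b ∈ A, (∃ c : ℝ, a = c • b) → a = b
  hWfin : (W : Set (Matrix.GeneralLinearGroup (Fin ℓ) ℝ)).Finite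
  hWorth : ∀ g ∈ W, Matrix.transpose (↑g : Matrix (Fin ℓ) (Fin ℓ) ℝ) * (↑g : Matrix (Fin ℓ) (Fin ℓ) ℝ) = 1
  hrefl : ∀ a ∈ A, ∃ g ∈ W, (↑g : Matrix (Fin ℓ) (Fin ℓ) ℝ) = reflMat a
  hhyp : ∀ g ∈ W, ∀ a : Fin ℓ → ℝ, a ≠ 0 → (↑g : Matrix (Fin ℓ) (Fin ℓ) ℝ) = reflMat a →
    ∃ b ∈ A, ∃ c : ℝ, a = c • b
  hgen : W = Subgroup.closure
    {g : Matrix.GeneralLinearGroup (Fin ℓ) ℝ | ∃ a ∈ A, (↑g : Matrix (Fin ℓ) (Fin ℓ) ℝ) = reflMat a}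
  blk : Fin ℓ → Fin t
  hblkA : ∀ a ∈ A, ∃ i, ∀ x, a x ≠ 0 → blk x = i
  P : Fin ℓ → MvPolynomial (Fin ℓ) ℝ
  deg : Fin ℓ → ℕ
  hdeg : ∀ c, 0 < deg c
  hPhom : ∀ c, (P c).IsHomogeneous (deg c)
  hPblock : ∀ c, blockPoly blk (blk c) (P c)
  hPinv : ∀ c, P c ∈ InvPoly W
  hPind : AlgebraicIndependent ℝ P
  hPgen : ∀ p : Spoly ℓ, p ∈ InvPoly W ↔ p ∈ Algebra.adjoin ℝ (Set.range P)
  top : Fin t → Fin ℓ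
  htop : ∀ i, blk (top i) = i
  htopdeg : ∀ i c, blk c = i → c ≠ top i → deg c < deg (top i)

/-! ### Primitive derivations and the connection `∇_D`. -/

/-- The covariant derivative `∇_D` on rational 1-forms: since `∇_D (dx_x) = 0`,
it acts componentwise, `∇_D(Σ f_x dx_x) = Σ D(f_x) dx_x`. -/
def nabVec (D : Derivation ℝ (Ffield ℓ) (Ffield ℓ)) (ω : OmF ℓ) : OmF ℓ :=
  fun x => D (ω x)

/-- `T = ker (D : R → R)`, viewed inside `F`. -/
def TF (W : Subgroup (Matrix.GeneralLinearGroup (Fin ℓ) ℝ))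
    (D : Derivation ℝ (Ffield ℓ) (Ffield ℓ)) : Set (Ffield ℓ) :=
  {y ∈ RF W | D y = 0}

/-- The differential `dP` of a polynomial, as a component vector: `(dP)_x = ∂P/∂x_x`. -/
def dPoly (p : Spoly ℓ) : OmF ℓ := fun x => toF (MvPolynomial.pderiv x p)

/-! ### Freeness of a submodule over a subring of coefficients. -/

/-- `v : ι → M` is a basis of the sub-`C`-module `Mod ⊆ M` over the coefficient
set `C ⊆ F`: the members of the family lie in `Mod`, every element of `Mod`
is a finite `C`-linear combination of them, and they are linearly independent
over `C`. -/
def IsBasisOver {ℓ : ℕ} {ι M : Type*} [AddCommMonoid M] [Module (Ffield ℓ) M]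
    (C : Set (Ffield ℓ)) (Mod : Set M) (v : ι → M) : Prop :=
  (∀ j, v j ∈ Mod) ∧
  (∀ ω ∈ Mod, ∃ c : ι →₀ Ffield ℓ, (∀ j, c j ∈ C) ∧ ω = c.sum fun j a => a • v j) ∧
  (∀ c : ι →₀ Ffield ℓ, (∀ j, c j ∈ C) → (c.sum fun j a => a • v j) = 0 → c = 0)

/-! ### Order of poles along a hyperplane. -/

/-- The localization `S_{(α)}` of `S` at the prime ideal `(α)`, viewed in `F`:
fractions with denominator prime to `α`. -/
def Sloc (a : Fin ℓ → ℝ) : Set (Ffield ℓ) :=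
  {y | ∃ p q : Spoly ℓ, ¬ linForm a ∣ q ∧ y * toF q = toF p}

/-- `ordEq a f k` says `ord_α(f) = k`, i.e. `k = min {j : α^j f ∈ S_{(α)}}`. -/
def ordEq (a : Fin ℓ → ℝ) (f : Ffield ℓ) (k : ℤ) : Prop :=
  linF a ^ k * f ∈ Sloc a ∧ ∀ j : ℤ, linF a ^ j * f ∈ Sloc a → k ≤ j

/-! ### Logarithmic derivation modules. -/

/-- The module `D(A,−∞)` of logarithmic derivations (Definition 4.1):
`Q^N ξ` regular and `(Q/α_H)^N ξ(β)` regular whenever `β ⊥ α_H`. -/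
def DerInf (A : Finset (Fin ℓ → ℝ)) : Set (Derivation ℝ (Ffield ℓ) (Ffield ℓ)) :=
  {ξ | ∃ N : ℕ,
    (∀ x, QF A ^ N * ξ (XF x) ∈ Sreg ℓ) ∧
    ∀ a ∈ A, ∀ b : Fin ℓ → ℝ, (∑ x, a x * b x) = 0 →
      (QF A / linF a) ^ N * ξ (linF b) ∈ Sreg ℓ}

/-- `D(A,m)` for a multiplicity `m : A → ℤ`:
`(Q/α_H)^N ξ(α_H) ∈ α_H^{m(H)} S` for `N ≫ 0`. -/
def DerMult (A : Finset (Fin ℓ → ℝ)) (m : (Fin ℓ → ℝ) → ℤ) :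
    Set (Derivation ℝ (Ffield ℓ) (Ffield ℓ)) :=
  {ξ ∈ DerInf A | ∃ N : ℕ, ∀ a ∈ A, ∃ p : Spoly ℓ,
    (QF A / linF a) ^ N * ξ (linF a) = linF a ^ m a * toF p}

/-- The component vector of a derivation: `ξ = Σ_x ξ(x_x) ∂_x`. -/
def derVec (ξ : Derivation ℝ (Ffield ℓ) (Ffield ℓ)) : OmF ℓ := fun x => ξ (XF x)

/-- `W`-invariant derivations (via the action on component vectors; the group
consists of orthogonal transformations). -/
def InvDer (W : Subgroup (Matrix.GeneralLinearGroup (Fin ℓ) ℝ)) :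
    Set (Derivation ℝ (Ffield ℓ) (Ffield ℓ)) :=
  {ξ | ∀ g ∈ W, vecAct g (derVec ξ) = derVec ξ}

/-- `D(A,−∞)^W`. -/
def DerInfW (A : Finset (Fin ℓ → ℝ)) (W : Subgroup (Matrix.GeneralLinearGroup (Fin ℓ) ℝ)) :
    Set (Derivation ℝ (Ffield ℓ) (Ffield ℓ)) := DerInf A ∩ InvDer W

/-- `D(A,m)^W = D(A,m) ∩ D(A,−∞)^W`. -/
def DerMultW (A : Finset (Fin ℓ → ℝ)) (W : Subgroup (Matrix.GeneralLinearGroup (Fin ℓ) ℝ))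
    (m : (Fin ℓ → ℝ) → ℤ) : Set (Derivation ℝ (Ffield ℓ) (Ffield ℓ)) :=
  DerMult A m ∩ InvDer W

/-- `I* : Ω_F → Der_F`, `I*(ω)(f) = I*(ω, df) = Σ_x ω_x ∂f/∂x_x`, defined using a
family `pd` of partial-derivative derivations of `F`. -/
def IstarDer (pd : Fin ℓ → Derivation ℝ (Ffield ℓ) (Ffield ℓ)) (ω : OmF ℓ) :
    Derivation ℝ (Ffield ℓ) (Ffield ℓ) :=
  ∑ x, ω x • pd x

/-- The covariant derivative `∇_D` on rational derivations: `(∇_D ξ)(α) = D(ξ(α))`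
for `α ∈ V*`, i.e. `∇_D ξ = Σ_x D(ξ(x_x)) ∂_x`. -/
def nabDer (pd : Fin ℓ → Derivation ℝ (Ffield ℓ) (Ffield ℓ))
    (D : Derivation ℝ (Ffield ℓ) (Ffield ℓ))
    (ξ : Derivation ℝ (Ffield ℓ) (Ffield ℓ)) : Derivation ℝ (Ffield ℓ) (Ffield ℓ) :=
  ∑ x, D (ξ (XF x)) • pd x

end CoxeterFormalization

section RegularFunctions

variable {ℓ : ℕ}

/-- The subring of regular functions, with carrier `Sreg ℓ`. -/
noncomputable def regularSubring (ℓ : ℕ) : Subring (Ffield ℓ) := (algebraMap (Spoly ℓ) (Ffield ℓ)).range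

lemma mem_Sreg_iff {y : Ffield ℓ} : y ∈ Sreg ℓ ↔ y ∈ regularSubring ℓ := Iff.rfl

lemma toF_mem (p : Spoly ℓ) : toF p ∈ regularSubring ℓ := ⟨p, rfl⟩

lemma zpow_mem_of_nonneg {R : Type*} [DivisionRing R] {T : Subring R} {y : R} (hy : y ∈ T) {k : ℤ}
    (hk : 0 ≤ k) : y ^ k ∈ T := by
  lift k to ℕ using hk
  simpa using pow_mem hy k

lemma linForm_ne_zero {b : Fin ℓ → ℝ} (hb : b ≠ 0) : linForm b ≠ 0 := by
  classical
  obtain ⟨i, hi⟩ := Function.ne_iff.mp hb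
  intro h
  apply hi
  simpa [linForm, Pi.single_apply] using congrArg (MvPolynomial.eval (Pi.single i (1 : ℝ))) h

lemma linF_ne_zero {b : Fin ℓ → ℝ} (hb : b ≠ 0) : linF b ≠ 0 := by
  intro h
  apply linForm_ne_zero hb
  apply IsFractionRing.injective (Spoly ℓ) (Ffield ℓ)
  simpa [linF, toF] using h

lemma XF_ne_zero (i : Fin ℓ) : XF i ≠ 0 := by
  simp [XF, toF]

lemma cF_zero : (cF 0 : Ffield ℓ) = 0 := by simp [cF, toF]

lemma cF_zpow_mem {r : ℝ} (hr : r ≠ 0) (k : ℤ) : (cF r : Ffield ℓ) ^ k ∈ regularSubring ℓ := by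
  have h : (cF r : Ffield ℓ)⁻¹ = cF r⁻¹ := by
    apply inv_eq_of_mul_eq_one_right
    rw [cF, cF, toF, toF, ← map_mul, ← map_mul, mul_inv_cancel₀ hr, map_one, map_one]
  rcases le_total 0 k with hk | hk
  · exact zpow_mem_of_nonneg (toF_mem _) hk
  · rw [← neg_neg k, zpow_neg, ← inv_zpow, h]
    exact zpow_mem_of_nonneg (toF_mem _) (by omega)

lemma QF_eq_prod (A : Finset (Fin ℓ → ℝ)) : QF A = ∏ b ∈ A, linF b := by
  simp [QF, linF, toF]

lemma QF_div_linF {A : Finset (Fin ℓ → ℝ)} [DecidableEq (Fin ℓ → ℝ)] {b : Fin ℓ → ℝ}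
    (hb : b ∈ A) (hb0 : b ≠ 0) : QF A / linF b = ∏ d ∈ A.erase b, linF d := by
  rw [QF_eq_prod, ← Finset.mul_prod_erase A _ hb, mul_div_cancel_left₀ _ (linF_ne_zero hb0)]

lemma prod_linF_mem (A : Finset (Fin ℓ → ℝ)) : ∏ b ∈ A, linF b ∈ regularSubring ℓ :=
  prod_mem fun _ _ => toF_mem _

lemma QmF_mem {A : Finset (Fin ℓ → ℝ)} {m : (Fin ℓ → ℝ) → ℤ} (hm : ∀ b, 0 ≤ m b) :
    QmF A m ∈ regularSubring ℓ :=
  prod_mem fun b _ => zpow_mem_of_nonneg (toF_mem _) (hm b)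

lemma linF_zpow_mul_QmF_mem {A : Finset (Fin ℓ → ℝ)} {m : (Fin ℓ → ℝ) → ℤ} (hm : ∀ b, 0 ≤ m b)
    {b : Fin ℓ → ℝ} (hb : b ∈ A) (hb0 : b ≠ 0) {k : ℤ} (hk : 0 ≤ k + m b) :
    linF b ^ k * QmF A m ∈ regularSubring ℓ := by
  classical
  rw [QmF, ← Finset.mul_prod_erase A _ hb, ← mul_assoc, ← zpow_add₀ (linF_ne_zero hb0)]
  exact mul_mem (zpow_mem_of_nonneg (toF_mem _) hk) (QmF_mem hm)

lemma linF_smul_coord [NeZero ℓ] (c : ℝ) :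
    linF (c • fun x : Fin ℓ => if x = 0 then (1 : ℝ) else 0) = cF c * XF 0 := by
  simp [linF, linForm, cF, XF, toF, ← map_mul, apply_ite MvPolynomial.C]

lemma sum_cF_mul_single (b : Fin ℓ → ℝ) (j : Fin ℓ) (y : Ffield ℓ) :
    ∑ x, cF (b x) * (if x = j then y else 0) = cF (b j) * y := by
  simp

/-- A sufficient criterion for a form `y dx_j` to lie in `Ω(A, m)`, where `a` is the only
hyperplane which may be a pole of `y`. -/
lemma single_mem_OmegaMult {A : Finset (Fin ℓ → ℝ)} (hA0 : ∀ b ∈ A, b ≠ 0)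
    {m : (Fin ℓ → ℝ) → ℤ} {a : Fin ℓ → ℝ} (ha : a ∈ A) {j : Fin ℓ} {y : Ffield ℓ} {N : ℕ}
    (hpole : linF a ^ N * y ∈ regularSubring ℓ)
    (hwedge : y ∈ regularSubring ℓ ∨ ∀ x, x ≠ j → a x = 0)
    (hother : ∀ b ∈ A, b ≠ a → linF a ^ N * linF b ^ m b * y ∈ regularSubring ℓ)
    (hself : linF a ^ m a * (cF (a j) * y) ∈ regularSubring ℓ) :
    (fun x : Fin ℓ => if x = j then y else 0) ∈ OmegaMult A m := by
  classical
  have hfac : ∀ b ∈ A, b ≠ a → ∃ t ∈ regularSubring ℓ, QF A / linF b = t * linF a := by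
    intro b hb hba
    refine ⟨_, prod_linF_mem ((A.erase b).erase a), ?_⟩
    rw [QF_div_linF hb (hA0 b hb),
      Finset.prod_erase_mul _ _ (Finset.mem_erase.mpr ⟨hba.symm, ha⟩)]
  have hmem : ∀ b ∈ A, QF A / linF b ∈ regularSubring ℓ := fun b hb => by
    rw [QF_div_linF hb (hA0 b hb)]
    exact prod_linF_mem _
  have hterm : ∀ (u : Ffield ℓ) (r : ℝ) (x : Fin ℓ), u * y ∈ regularSubring ℓ →
      u * (cF r * if x = j then y else 0) ∈ regularSubring ℓ := by
    intro u r x hu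
    split_ifs
    · rw [mul_left_comm]
      exact mul_mem (toF_mem _) hu
    · simp
  refine ⟨⟨N, fun x => ?_, fun b hb x z => ?_⟩, N, fun b hb => ?_⟩
  · rw [mem_Sreg_iff]
    dsimp only
    split_ifs
    · rw [QF_eq_prod, ← Finset.mul_prod_erase A _ ha, mul_pow, mul_right_comm]
      exact mul_mem hpole (pow_mem (prod_linF_mem _) N)
    · simp
  · rw [mem_Sreg_iff]
    dsimp only
    have main : (QF A / linF b) ^ N * y ∈ regularSubring ℓ →
        (QF A / linF b) ^ N * (cF (b x) * (if z = j then y else 0) -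
          cF (b z) * (if x = j then y else 0)) ∈ regularSubring ℓ := fun h => by
      rw [mul_sub]
      exact sub_mem (hterm _ _ _ h) (hterm _ _ _ h)
    by_cases hba : b = a
    · subst hba
      rcases hwedge with hy | hzero
      · exact main (mul_mem (pow_mem (hmem b hb) N) hy)
      · have : cF (b x) * (if z = j then y else 0) - cF (b z) * (if x = j then y else 0) = 0 := by
          by_cases hx : x = j <;> by_cases hz : z = j <;> simp [hx, hz, hzero, cF_zero]
        rw [this, mul_zero]
        exact zero_mem _
    · obtain ⟨t, ht, htb⟩ := hfac b hb hba
      apply main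
      rw [htb, mul_pow, mul_assoc]
      exact mul_mem (pow_mem ht N) hpole
  · rw [mem_Sreg_iff, sum_cF_mul_single]
    by_cases hba : b = a
    · subst hba
      rw [mul_assoc]
      exact mul_mem (pow_mem (hmem b hb) N) hself
    · obtain ⟨t, ht, htb⟩ := hfac b hb hba
      have : (QF A / linF b) ^ N * linF b ^ m b * (cF (b j) * y) =
          t ^ N * cF (b j) * (linF a ^ N * linF b ^ m b * y) := by
        rw [htb]; ring
      rw [this]
      exact mul_mem (mul_mem (pow_mem ht N) (toF_mem _)) (hother b hb hba)

end RegularFunctions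

section Statements

variable {ℓ t : ℕ}

/-- from the proof of Proposition 2.1 (2): with `H = {x₁ = 0}`
a hyperplane of `A` and `m' = |m|` away from `H`, `m' (H) = 0`, the forms
`η₁ = Q^{m'} dx₁/x₁^{m(H)}` and `η_j = Q^{m'} dx_j` (`j ≥ 2`) lie in `Ω(A,m)`. -/
theorem stmt19 [NeZero ℓ] (A : Finset (Fin ℓ → ℝ))
    (hA0 : ∀ a ∈ A, a ≠ 0)
    (hAprop : ∀ a ∈ A, ∀ b ∈ A, (∃ c : ℝ, a = c • b) → a = b)
    (m : (Fin ℓ → ℝ) → ℤ) (a : Fin ℓ → ℝ) (ha : a ∈ A)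
    (hax : ∃ c : ℝ, c ≠ 0 ∧ a = c • fun x : Fin ℓ => if x = 0 then (1 : ℝ) else 0) :
    ∀ j : Fin ℓ,
      (fun x : Fin ℓ => if x = j then
          QmF A (fun b => if b = a then 0 else |m b|) *
            (if j = 0 then XF 0 ^ (-(m a)) else 1)
        else 0) ∈ OmegaMult A m := by
  obtain ⟨c, hc, hac⟩ := hax
  intro j
  set m' : (Fin ℓ → ℝ) → ℤ := fun b => if b = a then 0 else |m b| with hm'
  have hnonneg : ∀ b, 0 ≤ m' b := fun b => by
    simp only [hm']
    split_ifs <;> simp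
  have hP := QmF_mem (A := A) hnonneg
  have hlin : linF a = cF c * XF 0 := by rw [hac, linF_smul_coord]
  have hzero : ∀ x, x ≠ 0 → a x = 0 := fun x hx => by simp [hac, hx]
  have hoff : ∀ b ∈ A, b ≠ a → linF b ^ m b * QmF A m' ∈ regularSubring ℓ := fun b hb hba => by
    apply linF_zpow_mul_QmF_mem hnonneg hb (hA0 b hb)
    simp only [hm', if_neg hba]
    linarith [neg_abs_le (m b)]
  by_cases hj : j = 0
  · subst hj
    simp only [if_true]
    have hcancel : ∀ k : ℤ, 0 ≤ k - m a → linF a ^ k * XF 0 ^ (-(m a)) ∈ regularSubring ℓ := by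
      intro k hk
      rw [hlin, mul_zpow, mul_assoc, ← zpow_add₀ (XF_ne_zero 0)]
      exact mul_mem (cF_zpow_mem hc k) (zpow_mem_of_nonneg (toF_mem _) (by omega))
    have hpow : linF a ^ (m a).natAbs * XF 0 ^ (-(m a)) ∈ regularSubring ℓ := by
      rw [← zpow_natCast]
      exact hcancel _ (by omega)
    apply single_mem_OmegaMult hA0 ha (N := (m a).natAbs)
    · rw [mul_left_comm]
      exact mul_mem hP hpow
    · exact Or.inr hzero
    · intro b hb hba
      have := mul_mem hpow (hoff b hb hba)
      rwa [mul_mul_mul_comm, mul_comm (XF 0 ^ _)] at this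
    · rw [mul_left_comm, mul_left_comm (linF a ^ _)]
      exact mul_mem (toF_mem _) (mul_mem hP (hcancel _ (by simp)))
  · simp only [if_neg hj, mul_one]
    apply single_mem_OmegaMult hA0 ha (N := 0)
    · simpa using hP
    · exact Or.inl hP
    · intro b hb hba
      simpa using hoff b hb hba
    · rw [hzero j hj, cF_zero, zero_mul, mul_zero]
      exact zero_mem _

end Statements
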